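/- Let r ≥ 1 and M ≤ N be natural numbers. The set of tuples (B1, …, Br, C1, …, Cr) of complex N × M matrices such that the associated rN × (r+1)M block matrix A_r has rank min(rN, (r+1)M) is a dense subset of the product space (Matrix (Fin N) (Fin M) ℂ)^{2r} with its standard topology. -/

import Mathlib

open Matrix

/-- The `rN × (r+1)M` block matrix whose `j`-th block row carries `B j` in block
column `j`, `C j` in block column `j+1`, and zero blocks elsewhere. -/
def alignBlock {r N M : ℕ} (B C : Fin r → Matrix (Fin N) (Fin M) ℂ) :
    Matrix (Fin r × Fin N) (Fin (r + 1) × Fin M) ℂ :=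
  Matrix.of fun p q =>
    if (q.1 : ℕ) = (p.1 : ℕ) then B p.1 p.2 q.2
    else if (q.1 : ℕ) = (p.1 : ℕ) + 1 then C p.1 p.2 q.2
    else 0

/-- The pattern of the matching in the `B` blocks. -/
def matchB (r N M : ℕ) : Fin r → Matrix (Fin N) (Fin M) ℂ := fun j =>
  Matrix.of fun i m => if (i : ℕ) = m ∧ (j : ℕ) * (N - M) ≤ m then 1 else 0

/-- The pattern of the matching in the `C` blocks. -/
def matchC (r N M : ℕ) : Fin r → Matrix (Fin N) (Fin M) ℂ := fun j =>
  Matrix.of fun i m => if ((i : ℕ) = m ∧ (m : ℕ) < (j : ℕ) * (N - M)) ∨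
    (M ≤ (i : ℕ) ∧ (i : ℕ) + (j : ℕ) * (N - M) = m + M) then 1 else 0

/-- The matching as a relation on natural numbers. -/
def matchRel (N M j i a m : ℕ) : Prop :=
  (a = j ∧ i = m ∧ j * (N - M) ≤ m) ∨
  (a = j + 1 ∧ ((i = m ∧ m < j * (N - M)) ∨ (M ≤ i ∧ i + j * (N - M) = m + M)))

open Classical in
theorem alignBlock_match (r N M : ℕ) (p : Fin r × Fin N) (q : Fin (r + 1) × Fin M) :
    alignBlock (matchB r N M) (matchC r N M) p q =
      if matchRel N M p.1 p.2 q.1 q.2 then 1 else 0 := by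
  obtain ⟨j, i⟩ := p
  obtain ⟨a, m⟩ := q
  simp only [alignBlock, matchB, matchC, matchRel, Matrix.of_apply]
  by_cases h1 : (a : ℕ) = j
  · simp [h1]
  · by_cases h2 : (a : ℕ) = j + 1
    · simp [h2]
    · simp [h1, h2]

theorem matchRel_left {N M j i a m a' m' : ℕ} (hm : m < M) (hm' : m' < M)
    (h : matchRel N M j i a m) (h' : matchRel N M j i a' m') : a = a' ∧ m = m' := by
  unfold matchRel at h h'
  generalize j * (N - M) = s at *
  omega

theorem matchRel_right {N M j i j' i' a m : ℕ} (hMN : M ≤ N) (hi : i < N) (hi' : i' < N)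
    (hm : m < M)
    (h : matchRel N M j i a m) (h' : matchRel N M j' i' a m) : j = j' ∧ i = i' := by
  unfold matchRel at h h'
  have key : j = j' ∨ j = j' + 1 ∨ j' = j + 1 := by omega
  rcases key with rfl | rfl | rfl
  · generalize j * (N - M) = s at *
    omega
  · rw [add_mul] at h
    generalize j' * (N - M) = s at *
    omega
  · rw [add_mul] at h'
    generalize j * (N - M) = s at *
    omega

theorem exists_col (r N M : ℕ) (hMN : M ≤ N) (h : r * N ≤ (r + 1) * M)
    (p : Fin r × Fin N) : ∃ q : Fin (r + 1) × Fin M, matchRel N M p.1 p.2 q.1 q.2 := by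
  obtain ⟨⟨j, hj⟩, ⟨i, hi⟩⟩ := p
  obtain ⟨D, rfl⟩ := Nat.exists_eq_add_of_le hMN
  have h1 : (j + 1) * D ≤ M := by
    have : (j + 1) * D ≤ r * D := Nat.mul_le_mul_right _ hj
    nlinarith
  simp only [matchRel, Nat.add_sub_cancel_left]
  rw [add_mul] at h1
  generalize hs : j * D = s at *
  by_cases hiM : i < M
  · by_cases hsi : s ≤ i
    · exact ⟨(⟨j, by omega⟩, ⟨i, hiM⟩), by simp; omega⟩
    · exact ⟨(⟨j + 1, by omega⟩, ⟨i, hiM⟩), by simp; omega⟩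
  · exact ⟨(⟨j + 1, by omega⟩, ⟨i + s - M, by omega⟩), by simp; omega⟩

theorem exists_row (r N M : ℕ) (hMN : M ≤ N) (h : (r + 1) * M ≤ r * N)
    (q : Fin (r + 1) × Fin M) : ∃ p : Fin r × Fin N, matchRel N M p.1 p.2 q.1 q.2 := by
  obtain ⟨⟨a, ha⟩, ⟨m, hm⟩⟩ := q
  obtain ⟨D, rfl⟩ := Nat.exists_eq_add_of_le hMN
  have h1 : M ≤ r * D := by nlinarith
  simp only [matchRel, Nat.add_sub_cancel_left]
  by_cases hs : a * D ≤ m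
  · have har : a < r := by
      rcases Nat.lt_or_ge a r with h2 | h2
      · exact h2
      · have := Nat.mul_le_mul_right D h2
        omega
    exact ⟨(⟨a, har⟩, ⟨m, by omega⟩), by simp; omega⟩
  · obtain _ | j := a
    · simp at hs
    rw [add_mul] at hs
    by_cases h3 : m < j * D
    · exact ⟨(⟨j, by omega⟩, ⟨m, by omega⟩), by simp; omega⟩
    · exact ⟨(⟨j, by omega⟩, ⟨m + M - j * D, by omega⟩), by simp; omega⟩

theorem exists_submatrix_one (r N M : ℕ) (hMN : M ≤ N) :
    ∃ (n : ℕ) (f : Fin n → Fin r × Fin N) (g : Fin n → Fin (r + 1) × Fin M),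
      n = min (r * N) ((r + 1) * M) ∧
      (alignBlock (matchB r N M) (matchC r N M)).submatrix f g = 1 := by
  classical
  rcases le_total (r * N) ((r + 1) * M) with h | h
  · choose g hg using exists_col r N M hMN h
    refine ⟨r * N, finProdFinEquiv.symm, g ∘ finProdFinEquiv.symm, by simp [h], ?_⟩
    ext k l
    rw [Matrix.submatrix_apply, alignBlock_match, Matrix.one_apply]
    refine if_congr ⟨fun hk => ?_, fun hk => hk ▸ hg _⟩ rfl rfl
    have h2 := matchRel_right hMN (Fin.is_lt _) (Fin.is_lt _) (Fin.is_lt _) hk (hg _)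
    exact finProdFinEquiv.symm.injective (Prod.ext (Fin.ext h2.1) (Fin.ext h2.2))
  · choose g hg using exists_row r N M hMN h
    refine ⟨(r + 1) * M, g ∘ finProdFinEquiv.symm, finProdFinEquiv.symm, by simp [h], ?_⟩
    ext k l
    rw [Matrix.submatrix_apply, alignBlock_match, Matrix.one_apply]
    refine if_congr ⟨fun hk => ?_, fun hk => hk ▸ hg _⟩ rfl rfl
    have h2 := matchRel_left (Fin.is_lt _) (Fin.is_lt _) hk (hg _)
    exact (finProdFinEquiv.symm.injective (Prod.ext (Fin.ext h2.1) (Fin.ext h2.2))).symm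

theorem alignBlock_add_smul {r N M : ℕ} (t : ℂ) (B C B' C' : Fin r → Matrix (Fin N) (Fin M) ℂ) :
    alignBlock (B + t • B') (C + t • C') = alignBlock B C + t • alignBlock B' C' := by
  ext p q
  simp only [alignBlock, Matrix.of_apply, Matrix.add_apply, Matrix.smul_apply, Pi.add_apply,
    Pi.smul_apply]
  split_ifs <;> simp

theorem rank_ge_of_submatrix {m n : Type*} [Fintype m] [Fintype n] {k : ℕ}
    (A : Matrix m n ℂ) (f : Fin k → m) (g : Fin k → n)
    (h : (A.submatrix f g).det ≠ 0) : k ≤ A.rank := by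
  have h1 : (A.submatrix f g).rank = k := by
    rw [Matrix.rank_of_isUnit _ ((Matrix.isUnit_iff_isUnit_det _).2 (isUnit_iff_ne_zero.2 h))]
    simp
  calc k = (A.submatrix f g).rank := h1.symm
    _ ≤ A.rank := Matrix.rank_submatrix_le _ _ _

/-- Lemma 11. For `M ≤ N`, the set of tuples
`(B₁,…,B_r, C₁,…,C_r)` of complex `N × M` matrices for which the associated
block matrix `A_r` has full rank `min (rN) ((r+1)M)` is dense in the product
space of all such tuples. -/
theorem alignBlock_full_rank_dense
    (r N M : ℕ) (hr : 1 ≤ r) (hMN : M ≤ N) :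
    Dense {p : (Fin r → Matrix (Fin N) (Fin M) ℂ)
        × (Fin r → Matrix (Fin N) (Fin M) ℂ) |
      (alignBlock p.1 p.2).rank = min (r * N) ((r + 1) * M)} := by
  obtain ⟨n, f, g, hn, hfg⟩ := exists_submatrix_one r N M hMN
  rintro ⟨B, C⟩
  have hcont : Continuous (fun t : ℂ => ((B + t • matchB r N M, C + t • matchC r N M) :
      (Fin r → Matrix (Fin N) (Fin M) ℂ) × (Fin r → Matrix (Fin N) (Fin M) ℂ))) := by
    fun_prop
  have hlim := (hcont.tendsto 0).mono_left (nhdsWithin_le_nhds (s := {(0 : ℂ)}ᶜ))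
  simp only [zero_smul, add_zero] at hlim
  refine mem_closure_of_tendsto hlim ?_
  set X := (alignBlock B C).submatrix f g with hX
  have hfin : {t : ℂ | (-X).charpoly.IsRoot t}.Finite :=
    Polynomial.finite_setOfPred_isRoot (Matrix.charpoly_monic _).ne_zero
  have hev : ∀ᶠ t in nhdsWithin (0 : ℂ) {0}ᶜ, ¬ (-X).charpoly.IsRoot t :=
    nhdsNE_le_cofinite _ hfin.compl_mem_cofinite
  filter_upwards [hev] with t ht
  change (alignBlock (B + t • matchB r N M) (C + t • matchC r N M)).rank = _
  apply le_antisymm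
  · refine le_min ?_ ?_
    · simpa using Matrix.rank_le_card_height (alignBlock (B + t • matchB r N M) (C + t • matchC r N M))
    · simpa using Matrix.rank_le_card_width (alignBlock (B + t • matchB r N M) (C + t • matchC r N M))
  · rw [← hn]
    apply rank_ge_of_submatrix _ f g
    intro hdet
    apply ht
    rw [Polynomial.IsRoot, Matrix.eval_charpoly, ← hdet, alignBlock_add_smul]
    congr 1
    rw [Matrix.submatrix_add, Matrix.submatrix_smul]
    simp only [Pi.add_apply, Pi.smul_apply, hfg, ← hX]
    rw [sub_neg_eq_add, add_comm, Matrix.scalar_apply, Matrix.smul_one_eq_diagonal]
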